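/- Let g be a filiform Lie algebra of dimension n over a field K of characteristic zero. Then g admits an adapted basis: there exist a basis e_1, …, e_n of g and a scalar α ∈ K (with α = 0 when n is odd) such that [e_1, e_i] = e_{i+1} for 2 ≤ i ≤ n − 1, [e_1, e_n] = 0, [e_i, e_j] ∈ span(e_{i+j}, …, e_n) for 2 ≤ i < j with i + j ≤ n, [e_i, e_j] = (−1)^i·α·e_n for 2 ≤ i < j with i + j = n + 1, and [e_i, e_j] = 0 for 2 ≤ i < j with i + j > n + 1. -/

import Mathlib

namespace Paper

open Module Submodule

/-- The lower central series of a Lie algebra, as submodules: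
`lcs K g 0 = C¹g = g` and `lcs K g m = C^{m+1} g = [g, C^m g]`. -/
def lcs (K : Type*) [Field K] (g : Type*) [LieRing g] [LieAlgebra K g] :
    ℕ → Submodule K g
  | 0 => ⊤
  | m + 1 => Submodule.span K {z : g | ∃ x y : g, y ∈ lcs K g m ∧ z = ⁅x, y⁆}

/-- `g` is a filiform Lie algebra of dimension `n`: it is `n`-dimensional, nilpotent,
with nil-index `n - 1`, i.e. `C^{n-1} g ≠ 0` and `C^n g = 0`. -/
def IsFiliform (K : Type*) [Field K] (g : Type*) [LieRing g] [LieAlgebra K g]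
    (n : ℕ) : Prop :=
  Module.finrank K g = n ∧ lcs K g (n - 2) ≠ ⊥ ∧ lcs K g (n - 1) = ⊥


theorem scal {K : Type*} [Field K] [CharZero K] (N : ℕ) (a : ℕ → ℕ → K)
    (h1 : ∀ i j, i + j + 1 ≤ N → a i j = - a j i)
    (h2 : ∀ i j, i + j + 2 ≤ N → a i j = a (i+1) j + a i (j+1))
    (h3 : ∀ i j, i + j + 2 ≤ N →
      a i j * a 0 (i+j+1) = a 0 i * a (i+1) j + a 0 j * a i (j+1))
    (h4 : 2 ≤ N → a 0 1 = 0) :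
    ∀ m i j, i + j = m → m + 2 ≤ N → a i j = 0 := by
  have diag : ∀ i, i + i + 1 ≤ N → a i i = 0 := by
    intro i hi
    have := h1 i i hi
    exact self_eq_neg.mp this
  intro m
  induction m using Nat.strong_induction_on with
  | _ m ih =>
  have lev : m + 2 ≤ N → ∀ i j, i + j = m → a i j = (-1)^i * a 0 m := by
    intro hm i
    induction i with
    | zero => intro j hj; obtain rfl : j = m := by omega
              simp
    | succ i ihi =>
      intro j hj
      have e1 := ihi (j+1) (by omega)
      have e2 := h2 i j (by omega)
      have e3 := ih (m-1) (by omega) i j (by omega) (by omega)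
      rw [pow_succ]
      linear_combination -e2 + e3 - e1
  intro i j hij hm
  rw [lev hm i j hij]
  suffices a 0 m = 0 by rw [this, mul_zero]
  rcases Nat.even_or_odd' m with ⟨r, rfl | rfl⟩
  · have e1 := lev hm r r (by omega)
    rw [diag r (by omega)] at e1
    simpa using e1.symm
  · rcases Nat.eq_zero_or_pos r with rfl | hr
    · simpa using h4 (by omega)
    have lev2 : ∀ i j, i + j = 2*r+2 →
        a i j = (-1)^i * (a 0 (2*r+2) - i * a 0 (2*r+1)) := by
      intro i
      induction i with
      | zero => intro j hj; obtain rfl : j = 2*r+2 := by omega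
                simp
      | succ i ihi =>
        intro j hj
        have e1 := ihi (j+1) (by omega)
        have e2 := h2 i j (by omega)
        have e3 := lev hm i j (by omega)
        rw [pow_succ]
        push_cast
        linear_combination -e2 + e3 - e1
    have m1 := lev2 (r+1) (r+1) (by omega)
    rw [diag (r+1) (by omega)] at m1
    have m2 : a 0 (2*r+2) = (r+1 : K) * a 0 (2*r+1) := by
      have : a 0 (2*r+2) - ((r+1 : ℕ) : K) * a 0 (2*r+1) = 0 := by simpa using m1.symm
      push_cast at this
      linear_combination this
    have j1 := h3 1 (2*r) (by omega)
    have z1 := h4 (by omega)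
    have z2 := ih (2*r) (by omega) 0 (2*r) (by omega) (by omega)
    have l1 := lev hm 1 (2*r) (by omega)
    rw [z1, z2, l1, show 1 + 2*r + 1 = 2*r+2 by ring, m2] at j1
    have hr1 : (r + 1 : K) ≠ 0 := by exact_mod_cast Nat.succ_ne_zero r
    have : (r+1 : K) * (a 0 (2*r+1))^2 = 0 := by linear_combination -j1
    simpa [hr1] using this

section
variable {K : Type*} [Field K] {g : Type*} [LieRing g] [LieAlgebra K g]

theorem lcs_lie (k : ℕ) (x y : g) (hy : y ∈ lcs K g k) : ⁅x, y⁆ ∈ lcs K g (k+1) := by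
  rw [lcs]
  exact Submodule.subset_span ⟨x, y, hy, rfl⟩

theorem lcs_succ_le (k : ℕ) : lcs K g (k+1) ≤ lcs K g k := by
  induction k with
  | zero => rw [lcs.eq_1]; exact le_top
  | succ k ih =>
    rw [lcs, Submodule.span_le]
    rintro z ⟨x, y, hy, rfl⟩
    exact lcs_lie k x y (ih hy)

theorem lcs_anti {k l : ℕ} (h : k ≤ l) : lcs K g l ≤ lcs K g k :=
  antitone_nat_of_succ_le lcs_succ_le h

theorem lcs_lie2 (a : ℕ) : ∀ (b : ℕ) (x y : g), x ∈ lcs K g a → y ∈ lcs K g b →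
    ⁅x, y⁆ ∈ lcs K g (a+b+1) := by
  induction a with
  | zero => intro b x y _ hy; rw [zero_add]; exact lcs_lie b x y hy
  | succ a ih =>
    intro b x y hx hy
    rw [lcs] at hx
    induction hx using Submodule.span_induction with
    | mem z hz =>
      obtain ⟨u, v, hv, rfl⟩ := hz
      rw [leibniz_lie u v y |> fun h => (eq_sub_of_add_eq h.symm)]
      refine Submodule.sub_mem _ ?_ ?_
      · have := lcs_lie _ u _ (ih b v y hv hy)
        convert this using 2; ring
      · have := ih (b+1) v _ hv (lcs_lie b u y hy)
        convert this using 2; ring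
    | zero => simp
    | add p q _ _ hp hq => rw [add_lie]; exact Submodule.add_mem _ hp hq
    | smul c p _ hp => rw [smul_lie]; exact Submodule.smul_mem _ c hp

theorem lcs_stable (k : ℕ) (h : lcs K g k = lcs K g (k+1)) :
    ∀ l, k ≤ l → lcs K g l = lcs K g k := by
  intro l hl
  induction l, hl using Nat.le_induction with
  | base => rfl
  | succ l hl ih => 
    rw [h]
    rw [lcs, lcs, ih]

theorem lcs_span (k : ℕ) (P : Submodule K g)
    (h : ∀ x y : g, y ∈ lcs K g k → ⁅x, y⁆ ∈ P) : lcs K g (k+1) ≤ P := by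
  rw [lcs, Submodule.span_le]
  rintro z ⟨x, y, hy, rfl⟩
  exact h x y hy
end

section
variable {K : Type*} [Field K] {g : Type*} [LieRing g] [LieAlgebra K g]

theorem codim_one [FiniteDimensional K g] (A B : Submodule K g) (hAB : A ≤ B)
    (hd : finrank K B ≤ finrank K A + 1) (x : g) (hx : x ∈ B) (hxA : x ∉ A) :
    ∀ z ∈ B, ∃ c : K, z - c • x ∈ A := by
  have hlt : A < A ⊔ K ∙ x := by
    refine lt_of_le_of_ne le_sup_left fun h => hxA ?_
    rw [h]
    exact (le_sup_right : K ∙ x ≤ A ⊔ K ∙ x) (Submodule.mem_span_singleton_self x)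
  have hle : A ⊔ K ∙ x ≤ B := sup_le hAB (by simpa using hx)
  have heq : A ⊔ K ∙ x = B := by
    apply Submodule.eq_of_le_of_finrank_le hle
    have := Submodule.finrank_lt_finrank_of_lt hlt
    omega
  intro z hz
  rw [← heq, Submodule.mem_sup] at hz
  obtain ⟨y, hy, w, hw, rfl⟩ := hz
  obtain ⟨c, rfl⟩ := Submodule.mem_span_singleton.mp hw
  exact ⟨c, by simpa using hy⟩

theorem fil_two_le (n : ℕ) (h : IsFiliform K g n) : 2 ≤ n := by
  obtain ⟨_, h2, h3⟩ := h
  by_contra hn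
  have : n - 2 = n - 1 := by omega
  rw [this] at h2
  exact h2 h3

theorem fil_strict (n : ℕ) (h : IsFiliform K g n) (k : ℕ) (hk : k + 2 ≤ n) :
    lcs K g (k+1) < lcs K g k := by
  obtain ⟨_, h2, h3⟩ := h
  refine lt_of_le_of_ne (lcs_succ_le k) fun e => h2 ?_
  rw [lcs_stable k e.symm (n-2) (by omega), ← lcs_stable k e.symm (n-1) (by omega), h3]

theorem fil_zero (n : ℕ) (h : IsFiliform K g n) (k : ℕ) (hk : n ≤ k + 1) :
    lcs K g k = ⊥ := by
  have := lcs_anti (K := K) (g := g) (show n - 1 ≤ k by omega)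
  rw [h.2.2] at this
  exact le_bot_iff.mp this

theorem fil_one [FiniteDimensional K g] (n : ℕ) (h : IsFiliform K g n) :
    finrank K (lcs K g 1) + 2 ≤ n := by
  have hn := fil_two_le n h
  by_contra hc
  rcases Nat.eq_or_lt_of_le hn with rfl | hn3
  · rw [fil_zero 2 h 1 (by omega)] at hc
    simp at hc
  have h01 := fil_strict n h 0 (by omega)
  obtain ⟨x, hx0, hx⟩ := SetLike.exists_of_lt h01
  have hc1 := codim_one (lcs K g 1) (lcs K g 0) h01.le
    (by rw [lcs.eq_1, finrank_top, h.1]; omega) x hx0 hx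
  have h12 := fil_strict n h 1 (by omega)
  refine absurd (lcs_span 0 (lcs K g 2) ?_) h12.not_ge
  intro u v hv
  obtain ⟨a, ha⟩ := hc1 u (by rw [lcs.eq_1]; trivial)
  obtain ⟨b, hb⟩ := hc1 v (by rw [lcs.eq_1]; trivial)
  have e : ⁅u, v⁆ = ⁅u, v - b • x⁆ - ⁅b • x, u - a • x⁆ := by
    simp only [lie_sub, lie_smul, smul_lie, lie_self, smul_zero, sub_zero]
    rw [← lie_skew u x, smul_neg]; abel
  rw [e]
  exact Submodule.sub_mem _ (lcs_lie 1 _ _ hb) (lcs_lie 1 _ _ ha)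

theorem fil_lo [FiniteDimensional K g] (n : ℕ) (h : IsFiliform K g n) :
    ∀ k m, m + k + 1 = n → k ≤ finrank K (lcs K g m) := by
  intro k
  induction k with
  | zero => intro _ _; exact Nat.zero_le _
  | succ k ih =>
    intro m hm
    have := Submodule.finrank_lt_finrank_of_lt (fil_strict n h m (by omega))
    have := ih (m+1) (by omega)
    omega

theorem fil_dim [FiniteDimensional K g] (n : ℕ) (h : IsFiliform K g n) (l : ℕ) (hl : 1 ≤ l) :
    finrank K (lcs K g l) ≤ finrank K (lcs K g (l+1)) + 1 := by
  have hn := fil_two_le n h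
  by_cases hln : n ≤ l + 1
  · rw [fil_zero n h l hln]; simp
  have up : ∀ k, k + 2 ≤ n → finrank K (lcs K g (k+1)) + k + 2 ≤ n := by
    intro k
    induction k with
    | zero => intro _; exact fil_one n h
    | succ k ih =>
      intro hk
      have := Submodule.finrank_lt_finrank_of_lt (fil_strict n h (k+1) (by omega))
      have := ih (by omega)
      omega
  have a1 := up (l-1) (by omega)
  rw [show l - 1 + 1 = l by omega] at a1
  have a2 := fil_lo n h (n-2-l) (l+1) (by omega)
  omega

def T (K : Type*) [Field K] (g : Type*) [LieRing g] [LieAlgebra K g] (l : ℕ) :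
    Submodule K g where
  carrier := {x | ∀ y ∈ lcs K g l, ⁅x, y⁆ ∈ lcs K g (l+2)}
  add_mem' := by
    intro a b ha hb y hy
    rw [add_lie]; exact Submodule.add_mem _ (ha y hy) (hb y hy)
  zero_mem' := by intro y hy; simp
  smul_mem' := by
    intro c a ha y hy
    rw [smul_lie]; exact Submodule.smul_mem _ c (ha y hy)

theorem exists_X [CharZero K] (n : ℕ) (h : IsFiliform K g n) :
    ∃ X : g, X ∉ lcs K g 1 ∧ ∀ l, l + 3 ≤ n → X ∉ T K g l := by
  have hn := fil_two_le n h
  by_contra hc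
  push Not at hc
  let p : Option (Fin (n-2)) → Submodule K g := fun o => o.elim (lcs K g 1) (fun l => T K g l)
  have hcov : ⋃ i, (p i : Set g) = Set.univ := by
    rw [Set.eq_univ_iff_forall]
    intro x
    rw [Set.mem_iUnion]
    by_cases hx : x ∈ lcs K g 1
    · exact ⟨none, hx⟩
    · obtain ⟨l, hl, hxl⟩ := hc x hx
      exact ⟨some ⟨l, by omega⟩, hxl⟩
  obtain ⟨i, hi⟩ := Subspace.exists_eq_top_of_iUnion_eq_univ hcov
  rcases i with _ | l
  · have := fil_strict n h 0 (by omega)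
    rw [lcs.eq_1] at this
    exact this.ne hi
  · have h12 := fil_strict n h (l+1) (by omega)
    refine h12.not_ge (lcs_span l _ ?_)
    intro x y hy
    have : x ∈ p (some l) := by rw [hi]; trivial
    exact this y hy

theorem setup [CharZero K] [FiniteDimensional K g] (n : ℕ) (h : IsFiliform K g n) :
    ∃ (X : g) (f : ℕ → g), (∀ k, f (k+1) = ⁅X, f k⁆) ∧
      (∀ k, k + 2 ≤ n → f k ∉ lcs K g (k+1)) ∧
      (∀ l, 1 ≤ l → ∀ z ∈ lcs K g l, ∃ c : K, z - c • f l ∈ lcs K g (l+1)) ∧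
      (∀ z, ∃ a b : K, z - a • X - b • f 0 ∈ lcs K g 1) ∧
      (4 ≤ n → ⁅f 0, f 1⁆ ∈ lcs K g 3) := by
  have hn := fil_two_le n h
  obtain ⟨X, hX1, hXT⟩ := exists_X n h
  have hone := fil_one n h
  have hlo := fil_lo n h (n-2) 1 (by omega)
  have hsup : lcs K g 1 < lcs K g 1 ⊔ K ∙ X := by
    refine lt_of_le_of_ne le_sup_left fun h => hX1 ?_
    rw [h]
    exact (le_sup_right : K ∙ X ≤ lcs K g 1 ⊔ K ∙ X) (Submodule.mem_span_singleton_self X)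
  have hsup1 := Submodule.finrank_lt_finrank_of_lt hsup
  have key : ∀ Y : g, Y ∉ lcs K g 1 ⊔ K ∙ X →
      (∀ z, ∃ a b : K, z - a • X - b • Y ∈ lcs K g 1) := by
    intro Y hY z
    obtain ⟨b, hb⟩ := codim_one (lcs K g 1 ⊔ K ∙ X) ⊤ le_top
      (by rw [finrank_top, h.1]; omega) Y trivial hY z trivial
    obtain ⟨y, hy, w, hw, e⟩ := Submodule.mem_sup.mp hb
    obtain ⟨a, rfl⟩ := Submodule.mem_span_singleton.mp hw
    refine ⟨a, b, ?_⟩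
    convert hy using 1
    rw [sub_right_comm, ← e]; simp
  have gen : ∀ Y : g, Y ∉ lcs K g 1 ⊔ K ∙ X → ∀ f : ℕ → g, f 0 = Y →
      (∀ k, f (k+1) = ⁅X, f k⁆) →
      (∀ k, f k ∈ lcs K g k) ∧ (∀ k, k + 2 ≤ n → f k ∉ lcs K g (k+1)) ∧
      (∀ l, 1 ≤ l → ∀ z ∈ lcs K g l, ∃ c : K, z - c • f l ∈ lcs K g (l+1)) := by
    intro Y hY f hf0 hf
    have hmem : ∀ k, f k ∈ lcs K g k := by
      intro k
      induction k with
      | zero => rw [lcs.eq_1]; trivial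
      | succ k ih => rw [hf]; exact lcs_lie k _ _ ih
    have hnot : ∀ k, k + 2 ≤ n → f k ∉ lcs K g (k+1) := by
      intro k
      induction k with
      | zero =>
        intro _ h0
        rw [hf0] at h0
        exact hY (hsup.le h0)
      | succ k ih =>
        intro hk hin
        rw [hf] at hin
        rcases Nat.eq_zero_or_pos k with rfl | hkp
        · rw [hf0] at hin
          have hXu : ∀ u, ⁅X, u⁆ ∈ lcs K g 2 := by
            intro u
            obtain ⟨a, b, hab⟩ := key Y hY u
            have e : ⁅X, u⁆ = ⁅X, u - a • X - b • Y⁆ + b • ⁅X, Y⁆ := by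
              simp only [lie_sub, lie_smul, lie_self, smul_zero]; abel
            rw [e]
            exact Submodule.add_mem _ (lcs_lie 1 _ _ hab) (Submodule.smul_mem _ _ hin)
          have hYu : ∀ u, ⁅Y, u⁆ ∈ lcs K g 2 := by
            intro u
            obtain ⟨a, b, hab⟩ := key Y hY u
            have e : ⁅Y, u⁆ = ⁅Y, u - a • X - b • Y⁆ - a • ⁅X, Y⁆ := by
              simp only [lie_sub, lie_smul, lie_self, smul_zero]
              rw [← lie_skew Y X, smul_neg]; abel
            rw [e]
            exact Submodule.sub_mem _ (lcs_lie 1 _ _ hab) (Submodule.smul_mem _ _ hin)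
          have h12 := fil_strict n h 1 (by omega)
          refine h12.not_ge (lcs_span 0 _ ?_)
          intro u v _
          obtain ⟨a, b, hab⟩ := key Y hY v
          have e : ⁅u, v⁆ = ⁅u, v - a • X - b • Y⁆ - a • ⁅X, u⁆ - b • ⁅Y, u⁆ := by
            simp only [lie_sub, lie_smul]
            rw [← lie_skew u X, ← lie_skew u Y, smul_neg, smul_neg]; abel
          rw [e]
          exact Submodule.sub_mem _ (Submodule.sub_mem _ (lcs_lie 1 _ _ hab)
            (Submodule.smul_mem _ _ (hXu u))) (Submodule.smul_mem _ _ (hYu u))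
        · refine hXT k (by omega) ?_
          intro y hy
          obtain ⟨c, hc⟩ := codim_one _ _ (lcs_succ_le k) (fil_dim n h k hkp) (f k)
            (hmem k) (ih (by omega)) y hy
          have e : ⁅X, y⁆ = ⁅X, y - c • f k⁆ + c • ⁅X, f k⁆ := by
            simp only [lie_sub, lie_smul]; abel
          rw [e]
          exact Submodule.add_mem _ (lcs_lie (k+1) _ _ hc) (Submodule.smul_mem _ _ hin)
    refine ⟨hmem, hnot, ?_⟩
    intro l hl z hz
    by_cases hln : l + 2 ≤ n
    · exact codim_one _ _ (lcs_succ_le l) (fil_dim n h l hl) (f l) (hmem l) (hnot l hln) z hz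
    · rw [fil_zero n h l (by omega), Submodule.mem_bot] at hz
      exact ⟨0, by simp [hz]⟩
  have hY0 : ∃ Y0, Y0 ∉ lcs K g 1 ⊔ K ∙ X := by
    by_contra hc
    push Not at hc
    have ht : lcs K g 1 ⊔ K ∙ X = ⊤ := by rw [eq_top_iff]; intro x _; exact hc x
    have := Submodule.finrank_add_le_finrank_add_finrank (lcs K g 1) (K ∙ X)
    rw [ht, finrank_top, h.1] at this
    have hX0 : X ≠ 0 := by rintro rfl; exact hX1 (Submodule.zero_mem _)
    have := finrank_span_singleton (K := K) hX0
    omega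
  obtain ⟨Y0, hY0⟩ := hY0
  let F : g → ℕ → g := fun Y k => Nat.rec Y (fun _ z => ⁅X, z⁆) k
  have hF : ∀ Y k, F Y (k+1) = ⁅X, F Y k⁆ := fun _ _ => rfl
  have hF0 : ∀ Y, F Y 0 = Y := fun _ => rfl
  obtain ⟨m0, -, c0⟩ := gen Y0 hY0 (F Y0) rfl (hF Y0)
  obtain ⟨c, hc⟩ := c0 2 (by omega) ⁅Y0, F Y0 1⁆ (lcs_lie 1 _ _ (m0 1))
  have hY : Y0 - c • X ∉ lcs K g 1 ⊔ K ∙ X := by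
    intro hin
    apply hY0
    have := Submodule.add_mem _ hin (Submodule.smul_mem _ c
      ((le_sup_right : K ∙ X ≤ lcs K g 1 ⊔ K ∙ X) (Submodule.mem_span_singleton_self X)))
    simpa using this
  obtain ⟨-, n1, c1⟩ := gen _ hY (F (Y0 - c • X)) rfl (hF _)
  refine ⟨X, F (Y0 - c • X), hF _, n1, c1, key _ hY, fun _ => ?_⟩
  rw [hF0]
  have e1 : F (Y0 - c • X) 1 = F Y0 1 := by
    change ⁅X, Y0 - c • X⁆ = ⁅X, Y0⁆
    simp
  rw [e1, sub_lie, smul_lie, ← hF]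
  exact hc
end
/-- Vergne: every filiform Lie algebra of dimension `n` over a field of
characteristic zero admits an adapted basis `e_1, …, e_n` (with `e_m = 0` for `m > n`),
with the constant `α` vanishing when `n` is odd. -/
theorem statement19 {K : Type*} [Field K] [CharZero K]
    {g : Type*} [LieRing g] [LieAlgebra K g]
    (n : ℕ) (hfil : IsFiliform K g n) :
    ∃ (E : ℕ → g) (α : K),
      (∃ b : Basis (Fin n) K g, ∀ i : Fin n, E ((i : ℕ) + 1) = b i) ∧
      (∀ m : ℕ, m = 0 ∨ n < m → E m = 0) ∧
      (∀ i : ℕ, 2 ≤ i → i ≤ n - 1 → ⁅E 1, E i⁆ = E (i + 1)) ∧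
      ⁅E 1, E n⁆ = 0 ∧
      (∀ i j : ℕ, 2 ≤ i → i < j → i + j ≤ n →
        ⁅E i, E j⁆ ∈ Submodule.span K (E '' Set.Icc (i + j) n)) ∧
      (∀ i j : ℕ, 2 ≤ i → i < j → i + j = n + 1 →
        ⁅E i, E j⁆ = (((-1 : K)) ^ i * α) • E n) ∧
      (∀ i j : ℕ, 2 ≤ i → i < j → j ≤ n → n + 1 < i + j → ⁅E i, E j⁆ = 0) ∧
      (Odd n → α = 0) := by
  have hn := fil_two_le n hfil
  have : FiniteDimensional K g := Module.finite_of_finrank_pos (by rw [hfil.1]; omega)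
  obtain ⟨X, f, hf, hnot, hco, hall, h34⟩ := setup n hfil
  have hmem : ∀ k, f k ∈ lcs K g k := by
    intro k
    induction k with
    | zero => rw [lcs.eq_1]; trivial
    | succ k ih => rw [hf]; exact lcs_lie k _ _ ih
  have huniq : ∀ l (c : K), l + 2 ≤ n → c • f l ∈ lcs K g (l+1) → c = 0 := by
    intro l c hl hc
    by_contra h0
    apply hnot l hl
    have := Submodule.smul_mem _ c⁻¹ hc
    rwa [smul_smul, inv_mul_cancel₀ h0, one_smul] at this
  have hex : ∀ i j, ∃ c : K, ⁅f i, f j⁆ - c • f (i+j+1) ∈ lcs K g (i+j+1+1) :=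
    fun i j => hco (i+j+1) (by omega) _ (lcs_lie2 i j _ _ (hmem i) (hmem j))
  choose a ha using hex
  have hR : ∀ i j k, k = i+j+1 → ∃ r ∈ lcs K g (k+1), ⁅f i, f j⁆ = a i j • f k + r := by
    rintro i j k rfl
    exact ⟨_, ha i j, by abel⟩
  have h1 : ∀ i j, i + j + 1 ≤ n - 2 → a i j = - a j i := by
    intro i j hij
    obtain ⟨r, hr, e⟩ := hR i j (i+j+1) rfl
    obtain ⟨s, hs, e'⟩ := hR j i (i+j+1) (by omega)
    rw [← sub_eq_zero]
    apply huniq (i+j+1) _ (by omega)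
    have : (a i j - -a j i) • f (i+j+1) = - r - s := by
      have sk := lie_skew (f i) (f j)
      rw [e, e'] at sk
      linear_combination (norm := module) -sk
    rw [this]
    exact Submodule.sub_mem _ (Submodule.neg_mem _ hr) hs
  have h2 : ∀ i j, i + j + 2 ≤ n - 2 → a i j = a (i+1) j + a i (j+1) := by
    intro i j hij
    obtain ⟨r, hr, e⟩ := hR i j (i+j+1) rfl
    obtain ⟨s, hs, e1⟩ := hR (i+1) j (i+j+1+1) (by omega)
    obtain ⟨t, ht, e2⟩ := hR i (j+1) (i+j+1+1) (by omega)
    rw [← sub_eq_zero]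
    apply huniq (i+j+1+1) _ (by omega)
    have : (a i j - (a (i+1) j + a i (j+1))) • f (i+j+1+1) = s + t - ⁅X, r⁆ := by
      have L := leibniz_lie X (f i) (f j)
      rw [← hf i, ← hf j, e, e1, e2, lie_add, lie_smul, ← hf] at L
      linear_combination (norm := module) L
    rw [this]
    exact Submodule.sub_mem _ (Submodule.add_mem _ hs ht) (lcs_lie _ _ _ hr)
  have h3 : ∀ i j, i + j + 2 ≤ n - 2 →
      a i j * a 0 (i+j+1) = a 0 i * a (i+1) j + a 0 j * a i (j+1) := by
    intro i j hij
    obtain ⟨r, hr, e⟩ := hR i j (i+j+1) rfl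
    obtain ⟨s, hs, e1⟩ := hR (i+1) j (i+j+1+1) (by omega)
    obtain ⟨t, ht, e2⟩ := hR i (j+1) (i+j+1+1) (by omega)
    obtain ⟨u, hu, e3⟩ := hR 0 i (i+1) (by omega)
    obtain ⟨v, hv, e4⟩ := hR 0 j (j+1) (by omega)
    obtain ⟨w, hw, e5⟩ := hR 0 (i+j+1) (i+j+1+1) (by omega)
    rw [← sub_eq_zero]
    apply huniq (i+j+1+1) _ (by omega)
    have : (a i j * a 0 (i+j+1) - (a 0 i * a (i+1) j + a 0 j * a i (j+1))) • f (i+j+1+1)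
        = a 0 i • s + a 0 j • t + ⁅u, f j⁆ + ⁅f i, v⁆ - a i j • w - ⁅f 0, r⁆ := by
      have L := leibniz_lie (f 0) (f i) (f j)
      rw [e, e3, e4, lie_add, lie_smul, add_lie, smul_lie, lie_add, lie_smul, e1, e2, e5] at L
      linear_combination (norm := module) L
    rw [this]
    have q1 : ⁅u, f j⁆ ∈ lcs K g (i+j+1+1+1) := by
      have := lcs_lie2 _ _ _ _ hu (hmem j)
      convert this using 2; ring
    have q2 : ⁅f i, v⁆ ∈ lcs K g (i+j+1+1+1) := by
      have := lcs_lie2 _ _ _ _ (hmem i) hv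
      convert this using 2; ring
    exact Submodule.sub_mem _ (Submodule.sub_mem _ (Submodule.add_mem _ (Submodule.add_mem _
      (Submodule.add_mem _ (Submodule.smul_mem _ _ hs) (Submodule.smul_mem _ _ ht)) q1) q2)
      (Submodule.smul_mem _ _ hw)) (lcs_lie _ _ _ hr)
  have h4 : 2 ≤ n - 2 → a 0 1 = 0 := by
    intro h
    obtain ⟨r, hr, e⟩ := hR 0 1 2 rfl
    apply huniq 2 _ (by omega)
    have q := h34 (by omega)
    rw [e] at q
    simpa using Submodule.sub_mem _ q hr
  have hz := scal (n-2) a h1 h2 h3 h4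
  -- the top level
  have htop : ∀ i j, i + j + 1 = n - 2 → a i j = (-1)^i * a 0 (n-3) := by
    intro i
    induction i with
    | zero =>
      intro j hj
      obtain rfl : j = n - 3 := by omega
      simp
    | succ i ih =>
      intro j hj
      have q1 := ih (j+1) (by omega)
      have q2 := h2 i j (by omega)
      have q3 := hz (i+j) i j rfl (by omega)
      rw [pow_succ]
      linear_combination -q2 + q3 - q1
  let E : ℕ → g := fun m => if m = 0 then 0 else if m = 1 then X else f (m-2)
  have E0 : E 0 = 0 := rfl
  have E1 : E 1 = X := rfl
  have E2 : ∀ k, E (k+2) = f k := fun k => rfl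
  have hsp : ∀ d l, 1 ≤ l → n ≤ l + 1 + d →
      lcs K g l ≤ Submodule.span K (E '' Set.Icc (l+2) n) := by
    intro d
    induction d with
    | zero => intro l _ hl; rw [fil_zero n hfil l (by omega)]; exact bot_le
    | succ d ih =>
      intro l hl hd z hzl
      by_cases hln : n ≤ l + 1
      · rw [fil_zero n hfil l hln, Submodule.mem_bot] at hzl
        rw [hzl]; exact Submodule.zero_mem _
      obtain ⟨c, hc⟩ := hco l hl z hzl
      have q := ih (l+1) (by omega) (by omega) hc
      have q' : z - c • f l ∈ Submodule.span K (E '' Set.Icc (l+2) n) :=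
        Submodule.span_mono (Set.image_mono (Set.Icc_subset_Icc_left (by omega))) q
      have q2 : f l ∈ Submodule.span K (E '' Set.Icc (l+2) n) :=
        Submodule.subset_span ⟨l+2, ⟨le_rfl, by omega⟩, E2 l⟩
      simpa using Submodule.add_mem _ q' (Submodule.smul_mem _ c q2)
  have hbs : ⊤ ≤ Submodule.span K (Set.range (fun i : Fin n => E ((i:ℕ)+1))) := by
    intro z _
    obtain ⟨p, q, hpq⟩ := hall z
    have s1 := hsp n 1 le_rfl (by omega) hpq
    have s2 : z - p • X - q • f 0 ∈
        Submodule.span K (Set.range (fun i : Fin n => E ((i:ℕ)+1))) := by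
      refine Submodule.span_mono ?_ s1
      rintro _ ⟨m, ⟨hm1, hm2⟩, rfl⟩
      exact ⟨⟨m-1, by omega⟩, by simp only []; congr 1; omega⟩
    have s3 : X ∈ Submodule.span K (Set.range (fun i : Fin n => E ((i:ℕ)+1))) :=
      Submodule.subset_span ⟨⟨0, by omega⟩, rfl⟩
    have s4 : f 0 ∈ Submodule.span K (Set.range (fun i : Fin n => E ((i:ℕ)+1))) :=
      Submodule.subset_span ⟨⟨1, by omega⟩, rfl⟩
    have := Submodule.add_mem _ (Submodule.add_mem _ s2 (Submodule.smul_mem _ q s4))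
      (Submodule.smul_mem _ p s3)
    simpa using this
  refine ⟨E, a 0 (n-3), ⟨basisOfTopLeSpanOfCardEqFinrank _ hbs (by simp [hfil.1]), ?_⟩,
    ?_, ?_, ?_, ?_, ?_, ?_, ?_⟩
  · intro i; simp
  · rintro m (rfl | hm)
    · rfl
    · obtain ⟨k, rfl⟩ : ∃ k, m = k + 2 := ⟨m-2, by omega⟩
      have := hmem k
      rw [fil_zero n hfil k (by omega), Submodule.mem_bot] at this
      rw [E2, this]
  · intro i hi _
    obtain ⟨k, rfl⟩ : ∃ k, i = k + 2 := ⟨i-2, by omega⟩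
    rw [E1, E2, show k + 2 + 1 = k + 1 + 2 by ring, E2, hf]
  · obtain ⟨k, hk⟩ : ∃ k, n = k + 2 := ⟨n-2, by omega⟩
    have := hmem (k+1)
    rw [fil_zero n hfil (k+1) (by omega), Submodule.mem_bot] at this
    rw [E1, hk, E2, ← hf, this]
  · intro i j hi hij hs
    obtain ⟨p, rfl⟩ : ∃ k, i = k + 2 := ⟨i-2, by omega⟩
    obtain ⟨q, rfl⟩ : ∃ k, j = k + 2 := ⟨j-2, by omega⟩
    obtain ⟨r, hr, e⟩ := hR p q (p+q+1) rfl
    rw [hz (p+q) p q rfl (by omega), zero_smul, zero_add] at e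
    rw [E2, E2, e]
    have := hsp n (p+q+1+1) (by omega) (by omega) hr
    rwa [show p + q + 1 + 1 + 2 = p + 2 + (q + 2) by ring] at this
  · intro i j hi hij hs
    obtain ⟨p, rfl⟩ : ∃ k, i = k + 2 := ⟨i-2, by omega⟩
    obtain ⟨q, rfl⟩ : ∃ k, j = k + 2 := ⟨j-2, by omega⟩
    obtain ⟨r, hr, e⟩ := hR p q (p+q+1) rfl
    rw [fil_zero n hfil _ (by omega), Submodule.mem_bot] at hr
    have hnn : n = p + q + 1 + 2 := by omega
    have en : E n = f (p+q+1) := by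
      conv_lhs => rw [hnn]
      exact E2 _
    rw [E2, E2, e, hr, add_zero, htop p q (by omega), en, pow_add]
    simp
  · intro i j hi hij hj hs
    obtain ⟨p, rfl⟩ : ∃ k, i = k + 2 := ⟨i-2, by omega⟩
    obtain ⟨q, rfl⟩ : ∃ k, j = k + 2 := ⟨j-2, by omega⟩
    have := lcs_lie2 p q _ _ (hmem p) (hmem q)
    rw [fil_zero n hfil _ (by omega), Submodule.mem_bot] at this
    rw [E2, E2, this]
  · rintro ⟨r, hr⟩
    have q := htop (r-1) (r-1) (by omega)
    have q1 := self_eq_neg.mp (h1 (r-1) (r-1) (by omega))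
    rw [q1] at q
    simpa using q.symm

end Paper
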